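/- There exist two 3-regular simple graphs on 16 vertices that are cospectral (their adjacency matrices have the same characteristic polynomial) such that one of them contains a Hamiltonian cycle and the other does not. -/

import Mathlib

open Matrix Polynomial

/-- The adjacency matrix over `ℝ` of a simple graph on `Fin n`. -/
noncomputable def adjMat {n : ℕ} (G : SimpleGraph (Fin n)) : Matrix (Fin n) (Fin n) ℝ :=
  letI : DecidableRel G.Adj := Classical.decRel G.Adj
  G.adjMatrix ℝ

/-- The chromatic index of a simple graph: the chromatic number of its line graph. -/
noncomputable def chromaticIndex {V : Type*} (G : SimpleGraph V) : ℕ∞ :=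
  G.lineGraph.chromaticNumber

/-- Matrices over a domain intertwined by a matrix of nonzero determinant have the same
characteristic polynomial. -/
theorem Matrix.charpoly_eq_of_mul_eq_mul {n R : Type*} [Fintype n] [DecidableEq n] [CommRing R]
    [IsDomain R] {A B P : Matrix n n R} (hP : P.det ≠ 0) (h : P * A = B * P) :
    A.charpoly = B.charpoly := by
  have key : P.map C * A.charmatrix = B.charmatrix * P.map C := by
    have hc : P.map C * A.map C = B.map C * P.map (C : R →+* R[X]) := by
      rw [← Matrix.map_mul, ← Matrix.map_mul, h]
    simp only [charmatrix, RingHom.mapMatrix_apply, mul_sub, sub_mul, hc,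
      (scalar_commute (X : R[X]) (Commute.all _) (P.map C)).eq]
  have hdet : (P.map (C : R →+* R[X])).det ≠ 0 := by
    rw [← RingHom.mapMatrix_apply, ← RingHom.map_det]
    exact C_ne_zero.mpr hP
  have := congrArg det key
  rw [det_mul, det_mul, mul_comm] at this
  exact mul_right_cancel₀ hdet this

namespace SimpleGraph

variable {V : Type*} [DecidableEq V]

/-- Given lists `N v` of neighbours, decide by exhaustive search whether a path ending at `v` whose
vertices are listed in `visited` can be prolonged by `n` further unvisited vertices so that it ends
at a neighbour of `t`. -/
def pathSearch (N : V → List V) (t : V) : ℕ → V → List V → Bool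
  | 0, v, _ => decide (t ∈ N v)
  | n + 1, v, visited =>
    (N v).any fun w => !decide (w ∈ visited) && pathSearch N t n w (w :: visited)

theorem Walk.IsPath.pathSearch_eq_true {G : SimpleGraph V} {N : V → List V}
    (hN : ∀ {u v}, G.Adj u v → v ∈ N u) {t u v : V} {p : G.Walk v u} (hp : p.IsPath)
    (ht : G.Adj u t) {visited : List V} (hvis : ∀ x ∈ visited, x ∈ p.support → x = v) :
    pathSearch N t p.length v visited = true := by
  induction p generalizing visited with
  | nil => simpa [pathSearch] using hN ht
  | cons h q ih =>
    rw [cons_isPath_iff] at hp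
    have hfresh : ∀ x ∈ visited, x ∉ q.support := fun x hx hxq =>
      hp.2 (hvis x hx (by simp [hxq]) ▸ hxq)
    simp only [length_cons, pathSearch, List.any_eq_true, Bool.and_eq_true, Bool.not_eq_true',
      decide_eq_false_iff_not]
    refine ⟨_, hN h, fun hw => hfresh _ hw q.start_mem_support, ih hp.1 ht fun x hx hxq => ?_⟩
    rcases List.mem_cons.mp hx with rfl | hx
    · rfl
    · exact absurd hxq (hfresh x hx)

theorem IsHamiltonian.pathSearch_eq_true [Fintype V] [Nontrivial V] {G : SimpleGraph V}
    {N : V → List V} (hN : ∀ {u v}, G.Adj u v → v ∈ N u) (hG : G.IsHamiltonian) (v : V) :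
    pathSearch N v (Fintype.card V - 1) v [v] = true := by
  obtain ⟨p, hp⟩ := hG.exists_isHamiltonianCycle v
  have hlen := hp.length_eq
  cases p with
  | nil => exact absurd rfl hp.isCycle.ne_nil
  | cons h q =>
    have hq : q.reverse.IsPath := (Walk.cons_isCycle_iff q h).mp hp.isCycle |>.1.reverse
    have := hq.pathSearch_eq_true hN h.symm (visited := [v]) (by simp)
    rwa [Walk.length_reverse, show q.length = Fintype.card V - 1 by
      rw [← hlen, Walk.length_cons, Nat.add_sub_cancel]] at this

theorem cycleGraph.isHamiltonian (n : ℕ) : (cycleGraph (n + 3)).IsHamiltonian := fun _ =>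
  ⟨0, cycleGraph.cycle n, Walk.isHamiltonianCycle_iff_isCycle_and_length_eq.mpr
    ⟨cycleGraph.isCycle_cycle, by simp⟩⟩

/-- The simple graph in which the neighbours of `v` are the members of `N v`. -/
def ofNeighborLists (N : V → List V) (hsymm : ∀ u v, v ∈ N u → u ∈ N v) (hirr : ∀ v, v ∉ N v) :
    SimpleGraph V where
  Adj u v := v ∈ N u
  symm := ⟨hsymm⟩
  loopless := ⟨hirr⟩

theorem ncard_neighborSet_ofNeighborLists (N : V → List V) (hsymm hirr) (v : V) :
    ((ofNeighborLists N hsymm hirr).neighborSet v).ncard = (N v).toFinset.card := by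
  rw [← Set.ncard_coe_finset]
  congr 1
  ext w
  simp [ofNeighborLists]

end SimpleGraph

/-- The integer matrix whose `(i, j)` entry indicates whether `j` is listed in `N i`. -/
def listAdjMatrix {n : ℕ} (N : Fin n → List (Fin n)) : Matrix (Fin n) (Fin n) ℤ :=
  of fun i j => if j ∈ N i then 1 else 0

theorem charpoly_adjMat_ofNeighborLists {n : ℕ} (N : Fin n → List (Fin n)) (hsymm hirr) :
    (adjMat (SimpleGraph.ofNeighborLists N hsymm hirr)).charpoly =
      (listAdjMatrix N).charpoly.map (Int.castRingHom ℝ) := by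
  rw [← charpoly_map]
  congr 1
  ext i j
  rw [adjMat, SimpleGraph.adjMatrix_apply]
  by_cases h : j ∈ N i <;> simp [listAdjMatrix, SimpleGraph.ofNeighborLists, h]

/-- Neighbour lists of a cubic graph containing the Hamiltonian cycle `0, 1, …, 15`. -/
def hamiltonianNeighbors : Fin 16 → List (Fin 16) :=
  ![[1, 14, 15], [0, 2, 7], [1, 3, 11], [2, 4, 9],
    [3, 5, 6], [4, 6, 13], [4, 5, 7], [1, 6, 8],
    [7, 9, 15], [3, 8, 10], [9, 11, 12], [2, 10, 12],
    [10, 11, 13], [5, 12, 14], [0, 13, 15], [0, 8, 14]]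

/-- Neighbour lists of the Petersen graph with three of its vertices replaced by triangles. -/
def truncatedPetersenNeighbors : Fin 16 → List (Fin 16) :=
  ![[4, 8, 15], [2, 3, 9], [1, 3, 10], [1, 2, 11],
    [0, 5, 12], [4, 6, 10], [5, 7, 14], [6, 8, 9],
    [0, 7, 9], [1, 7, 8], [2, 5, 15], [3, 12, 13],
    [4, 11, 13], [11, 12, 14], [6, 13, 15], [0, 10, 14]]

/-- A matrix intertwining the adjacency matrices of the two graphs. -/
def intertwiner : Matrix (Fin 16) (Fin 16) ℤ :=
  !![0, 1, 0, 0, 0, 0, 0, 0, 0, -1, 1, 1, 0, 0, 0, -1;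
     -1, 0, 0, 0, 1, 0, 0, 0, 0, 0, 0, 1, 0, 0, 0, 0;
     0, 0, 0, 0, 0, 1, 0, 0, 0, 0, 0, 0, 0, 0, 0, 0;
     1, 0, 0, 0, 0, 0, 1, 0, 0, 0, 0, -1, 0, 0, 0, 0;
     1, 0, 1, 0, 0, 0, 0, 0, -1, 0, -1, 0, 0, 0, 0, 1;
     0, 0, 0, 1, 0, 0, 0, -1, 0, 0, 0, 0, 0, 0, 1, 0;
     0, -1, 0, 0, 1, 0, -1, 0, 0, 1, 1, 0, 0, 0, 0, 0;
     -1, 0, 0, 1, 0, 0, 0, -1, 0, 1, 1, 1, 1, 0, -1, -1;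
     -1, 0, 1, 0, 0, 0, 0, 0, -1, 1, 1, 1, 1, 0, -1, -1;
     -1, -1, 1, 1, 0, 0, 0, 0, 0, 0, 1, 1, 1, 0, -1, -1;
     0, 0, 0, 0, 0, 0, 0, 0, 0, 0, 0, 0, 0, 1, 0, 0;
     1, 1, -1, 0, 0, 0, 0, 1, 0, 0, -1, -1, -1, 0, 1, 1;
     1, 1, 0, 0, 0, 0, 0, 0, 1, -1, -1, -1, -1, 0, 1, 1;
     1, 0, 0, -1, 0, 0, 0, 1, 1, 0, -1, -1, -1, 0, 1, 1;
     0, 0, -1, 0, -1, 0, 1, 0, 1, 0, 0, 0, 0, 0, 0, 1;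
     0, 0, 0, -1, 0, 0, 0, 1, 0, 0, 0, 0, 1, 0, 0, 0]

/-- The inverse of `intertwiner` modulo `2`. -/
def intertwinerInvModTwo : Matrix (Fin 16) (Fin 16) (ZMod 2) :=
  !![0, 0, 0, 0, 1, 0, 1, 0, 0, 1, 0, 1, 1, 1, 1, 0;
     1, 0, 0, 0, 1, 1, 1, 1, 0, 0, 0, 0, 1, 1, 1, 1;
     1, 0, 0, 0, 1, 1, 1, 1, 1, 0, 0, 0, 0, 1, 1, 1;
     1, 0, 0, 0, 1, 1, 1, 0, 1, 1, 0, 0, 1, 0, 1, 1;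
     1, 1, 0, 0, 1, 0, 0, 1, 1, 0, 0, 0, 1, 1, 0, 0;
     0, 0, 1, 0, 0, 0, 0, 0, 0, 0, 0, 0, 0, 0, 0, 0;
     1, 0, 0, 1, 1, 0, 0, 1, 1, 0, 0, 0, 1, 1, 0, 0;
     1, 0, 0, 0, 1, 1, 1, 0, 1, 0, 0, 1, 1, 0, 1, 1;
     1, 0, 0, 0, 1, 1, 1, 0, 0, 1, 0, 1, 0, 1, 1, 1;
     1, 0, 0, 0, 1, 1, 1, 1, 0, 1, 0, 1, 0, 0, 1, 1;
     0, 1, 0, 1, 0, 0, 1, 0, 0, 1, 0, 1, 1, 1, 0, 0;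
     1, 0, 0, 0, 0, 0, 1, 1, 1, 1, 0, 1, 0, 0, 1, 0;
     0, 0, 0, 0, 0, 0, 0, 0, 0, 1, 0, 1, 0, 0, 0, 1;
     0, 0, 0, 0, 0, 0, 0, 0, 0, 0, 1, 0, 0, 0, 0, 0;
     0, 0, 0, 0, 0, 1, 0, 0, 0, 1, 0, 1, 0, 0, 0, 0;
     0, 1, 0, 1, 0, 0, 0, 1, 1, 1, 0, 1, 0, 0, 1, 0]

theorem intertwiner_mul_listAdjMatrix :
    intertwiner * listAdjMatrix hamiltonianNeighbors =
      listAdjMatrix truncatedPetersenNeighbors * intertwiner := by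
  decide +kernel

theorem det_intertwiner_ne_zero : intertwiner.det ≠ 0 := by
  have h : intertwiner.map (Int.castRingHom (ZMod 2)) * intertwinerInvModTwo = 1 := by
    decide +kernel
  intro h0
  apply det_ne_zero_of_right_inverse h
  rw [← RingHom.mapMatrix_apply, ← RingHom.map_det, h0, map_zero]

/-- A cubic graph on 16 vertices containing the Hamiltonian cycle `0, 1, …, 15`. -/
def hamiltonianCubicGraph : SimpleGraph (Fin 16) :=
  .ofNeighborLists hamiltonianNeighbors (by decide +kernel) (by decide +kernel)

/-- The Petersen graph with three of its vertices replaced by triangles. -/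
def truncatedPetersenGraph : SimpleGraph (Fin 16) :=
  .ofNeighborLists truncatedPetersenNeighbors (by decide +kernel) (by decide +kernel)

theorem hamiltonianCubicGraph_isHamiltonian : hamiltonianCubicGraph.IsHamiltonian := by
  refine (SimpleGraph.cycleGraph.isHamiltonian 13).mono fun u v huv => ?_
  have h : ∀ u v : Fin 16, u - v = 1 ∨ v - u = 1 → v ∈ hamiltonianNeighbors u := by
    decide +kernel
  exact h u v (SimpleGraph.cycleGraph_adj.mp huv)

theorem truncatedPetersenGraph_not_isHamiltonian : ¬ truncatedPetersenGraph.IsHamiltonian := by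
  intro h
  have hsearch := h.pathSearch_eq_true (N := truncatedPetersenNeighbors) id 0
  have hfail : SimpleGraph.pathSearch truncatedPetersenNeighbors 0 15 0 [0] = false := by
    decide +kernel
  rw [Fintype.card_fin, hfail] at hsearch
  exact Bool.false_ne_true hsearch

/-- There exist two cospectral cubic graphs on 16 vertices such that one is Hamiltonian
and the other is not. -/
theorem exists_cospectral_cubic_graphs_hamiltonian_nonhamiltonian :
    ∃ G H : SimpleGraph (Fin 16),
      (∀ v, (G.neighborSet v).ncard = 3) ∧
      (∀ v, (H.neighborSet v).ncard = 3) ∧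
      (adjMat G).charpoly = (adjMat H).charpoly ∧
      G.IsHamiltonian ∧
      ¬ H.IsHamiltonian := by
  refine ⟨hamiltonianCubicGraph, truncatedPetersenGraph, fun v => ?_, fun v => ?_, ?_,
    hamiltonianCubicGraph_isHamiltonian, truncatedPetersenGraph_not_isHamiltonian⟩
  · rw [hamiltonianCubicGraph, SimpleGraph.ncard_neighborSet_ofNeighborLists]
    revert v
    decide +kernel
  · rw [truncatedPetersenGraph, SimpleGraph.ncard_neighborSet_ofNeighborLists]
    revert v
    decide +kernel
  · rw [hamiltonianCubicGraph, truncatedPetersenGraph, charpoly_adjMat_ofNeighborLists,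
      charpoly_adjMat_ofNeighborLists,
      charpoly_eq_of_mul_eq_mul det_intertwiner_ne_zero intertwiner_mul_listAdjMatrix]
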